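/- Let μ^N be the Wasserstein barycenter with equal weights 1/N of measures μ_{1/N}, μ_{2/N}, …, μ_{N/N}, where t ↦ μ_t is a weakly continuous curve of probability measures on a bounded domain M ⊆ ℝⁿ. Then any weak limit μ^∞ of a subsequence of (μ^N) is a barycenter of the curve, i.e., minimizes μ ↦ ∫₀¹ W₂²(μ, μ_t) dt over P₂(ℝⁿ). -/

import Mathlib

open MeasureTheory Set

noncomputable section

/-- `ℝⁿ` with the Euclidean norm. -/
abbrev En (n : ℕ) := EuclideanSpace ℝ (Fin n)

/-- `γ` is a coupling of `μ` and `ν`. -/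
def IsCoupling {n : ℕ} (γ : Measure (En n × En n)) (μ ν : Measure (En n)) : Prop :=
  γ.map Prod.fst = μ ∧ γ.map Prod.snd = ν

/-- The squared quadratic Wasserstein distance `W₂²(μ,ν)`. -/
def W2sq {n : ℕ} (μ ν : Measure (En n)) : ℝ :=
  sInf { c | ∃ γ : Measure (En n × En n), IsCoupling γ μ ν ∧ c = ∫ p, ‖p.1 - p.2‖ ^ 2 ∂γ }

/-- `μ` has finite second moment. -/
def FinSecMom {n : ℕ} (μ : Measure (En n)) : Prop := Integrable (fun x => ‖x‖ ^ 2) μ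

/-- The curve `t ↦ μ t` is weakly continuous on `s`. -/
def WeakContOn {n : ℕ} (μ : ℝ → Measure (En n)) (s : Set ℝ) : Prop :=
  ∀ f : BoundedContinuousFunction (En n) ℝ, ContinuousOn (fun t => ∫ x, f x ∂(μ t)) s

/-- `μb` is a barycenter of the curve `t ↦ μ t`, `t ∈ [0,1]`: it minimizes
`ν ↦ ∫₀¹ W₂²(μ_t, ν) dt` over probability measures with finite second moment. -/
def IsBarycenter {n : ℕ} (μ : ℝ → Measure (En n)) (μb : Measure (En n)) : Prop :=
  IsProbabilityMeasure μb ∧ FinSecMom μb ∧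
    ∀ ν : Measure (En n), IsProbabilityMeasure ν → FinSecMom ν →
      ∫ t in Icc (0:ℝ) 1, W2sq (μ t) μb ≤ ∫ t in Icc (0:ℝ) 1, W2sq (μ t) ν

section Wasserstein

open Filter Topology
open scoped ENNReal NNReal BoundedContinuousFunction

variable {n : ℕ}

/-- The squared quadratic Wasserstein distance with values in `[0, ∞]`. -/
def W2e (μ ν : Measure (En n)) : ℝ≥0∞ :=
  ⨅ (γ : Measure (En n × En n)) (_ : IsCoupling γ μ ν), ∫⁻ p, ‖p.1 - p.2‖ₑ ^ 2 ∂γ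

/-- The second moment with values in `[0, ∞]`. -/
def secMom (μ : Measure (En n)) : ℝ≥0∞ := ∫⁻ x, ‖x‖ₑ ^ 2 ∂μ

lemma W2e_le {μ ν : Measure (En n)} {γ : Measure (En n × En n)} (h : IsCoupling γ μ ν) :
    W2e μ ν ≤ ∫⁻ p, ‖p.1 - p.2‖ₑ ^ 2 ∂γ := iInf₂_le γ h

lemma secMom_lt_top {μ : Measure (En n)} (h : FinSecMom μ) : secMom μ < ∞ := by
  have := h.2
  simpa [HasFiniteIntegral, secMom] using this

lemma finSecMom_of_secMom_lt_top {μ : Measure (En n)} (h : secMom μ < ∞) : FinSecMom μ := by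
  refine ⟨by fun_prop, ?_⟩
  simpa [HasFiniteIntegral, secMom] using h

lemma enorm_add_sq_le (x y : En n) : ‖x + y‖ₑ ^ 2 ≤ 2 * ‖x‖ₑ ^ 2 + 2 * ‖y‖ₑ ^ 2 := by
  have h : ‖x + y‖₊ ^ 2 ≤ 2 * ‖x‖₊ ^ 2 + 2 * ‖y‖₊ ^ 2 := by
    rw [← NNReal.coe_le_coe]
    push_cast
    nlinarith [norm_add_le x y, norm_nonneg (x + y), sq_nonneg (‖x‖ - ‖y‖)]
  simp only [enorm_eq_nnnorm]
  exact_mod_cast h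

lemma enorm_sub_sq_le (x y : En n) : ‖x - y‖ₑ ^ 2 ≤ 2 * ‖x‖ₑ ^ 2 + 2 * ‖y‖ₑ ^ 2 := by
  simpa [sub_eq_add_neg] using enorm_add_sq_le x (-y)

lemma IsCoupling.lintegral_fst {γ : Measure (En n × En n)} {μ ν : Measure (En n)}
    (h : IsCoupling γ μ ν) {g : En n → ℝ≥0∞} (hg : Measurable g) :
    ∫⁻ p, g p.1 ∂γ = ∫⁻ x, g x ∂μ := by
  rw [← h.1, lintegral_map hg measurable_fst]

lemma IsCoupling.lintegral_snd {γ : Measure (En n × En n)} {μ ν : Measure (En n)}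
    (h : IsCoupling γ μ ν) {g : En n → ℝ≥0∞} (hg : Measurable g) :
    ∫⁻ p, g p.2 ∂γ = ∫⁻ x, g x ∂ν := by
  rw [← h.2, lintegral_map hg measurable_snd]

lemma IsCoupling.isProbabilityMeasure {γ : Measure (En n × En n)} {μ ν : Measure (En n)}
    [hμ : IsProbabilityMeasure μ] (h : IsCoupling γ μ ν) : IsProbabilityMeasure γ := by
  have : IsProbabilityMeasure (γ.map Prod.fst) := by rwa [h.1]
  exact Measure.isProbabilityMeasure_of_map Prod.fst

lemma isCoupling_prod (μ ν : Measure (En n)) [IsProbabilityMeasure μ] [IsProbabilityMeasure ν] :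
    IsCoupling (μ.prod ν) μ ν := by
  constructor <;> simp

lemma IsCoupling.lintegral_le {γ : Measure (En n × En n)} {μ ν : Measure (En n)}
    (h : IsCoupling γ μ ν) :
    ∫⁻ p, ‖p.1 - p.2‖ₑ ^ 2 ∂γ ≤ 2 * secMom μ + 2 * secMom ν := by
  calc ∫⁻ p, ‖p.1 - p.2‖ₑ ^ 2 ∂γ ≤ ∫⁻ p, 2 * ‖p.1‖ₑ ^ 2 + 2 * ‖p.2‖ₑ ^ 2 ∂γ :=
        lintegral_mono fun p => enorm_sub_sq_le _ _
    _ = 2 * secMom μ + 2 * secMom ν := by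
        rw [lintegral_add_left (by fun_prop), lintegral_const_mul _ (by fun_prop),
          lintegral_const_mul _ (by fun_prop),
          h.lintegral_fst (g := fun x => ‖x‖ₑ ^ 2) (by fun_prop),
          h.lintegral_snd (g := fun x => ‖x‖ₑ ^ 2) (by fun_prop)]
        rfl

lemma W2e_le_secMom (μ ν : Measure (En n)) [IsProbabilityMeasure μ] [IsProbabilityMeasure ν] :
    W2e μ ν ≤ 2 * secMom μ + 2 * secMom ν :=
  (W2e_le (isCoupling_prod μ ν)).trans (isCoupling_prod μ ν).lintegral_le

lemma secMom_le_W2e (μ ν : Measure (En n)) :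
    secMom ν ≤ 2 * secMom μ + 2 * W2e μ ν := by
  simp only [W2e, ENNReal.mul_iInf_of_ne two_ne_zero ENNReal.ofNat_ne_top, ENNReal.add_iInf]
  refine le_iInf₂ fun γ h => ?_
  calc secMom ν = ∫⁻ p, ‖p.2‖ₑ ^ 2 ∂γ := (h.lintegral_snd (by fun_prop)).symm
    _ ≤ ∫⁻ p, 2 * ‖p.1‖ₑ ^ 2 + 2 * ‖p.1 - p.2‖ₑ ^ 2 ∂γ :=
        lintegral_mono fun p => by simpa using enorm_sub_sq_le p.1 (p.1 - p.2)
    _ = _ := by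
        rw [lintegral_add_left (by fun_prop), lintegral_const_mul _ (by fun_prop),
          lintegral_const_mul _ (by fun_prop),
          h.lintegral_fst (g := fun x => ‖x‖ₑ ^ 2) (by fun_prop)]
        rfl

lemma W2sq_nonneg (μ ν : Measure (En n)) : 0 ≤ W2sq μ ν := by
  refine Real.sInf_nonneg ?_
  rintro c ⟨γ, -, rfl⟩
  exact integral_nonneg fun p => by positivity

lemma W2e_lt_top {μ ν : Measure (En n)} [IsProbabilityMeasure μ] [IsProbabilityMeasure ν]
    (hμ : secMom μ < ∞) (hν : secMom ν < ∞) : W2e μ ν < ∞ :=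
  (W2e_le_secMom μ ν).trans_lt (ENNReal.add_lt_top.2
    ⟨ENNReal.mul_lt_top ENNReal.ofNat_lt_top hμ, ENNReal.mul_lt_top ENNReal.ofNat_lt_top hν⟩)

lemma ofReal_W2sq {μ ν : Measure (En n)} [IsProbabilityMeasure μ] [IsProbabilityMeasure ν]
    (hμ : secMom μ < ∞) (hν : secMom ν < ∞) : ENNReal.ofReal (W2sq μ ν) = W2e μ ν := by
  have key : ∀ γ, IsCoupling γ μ ν →
      ENNReal.ofReal (∫ p, ‖p.1 - p.2‖ ^ 2 ∂γ) = ∫⁻ p, ‖p.1 - p.2‖ₑ ^ 2 ∂γ := by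
    intro γ h
    have hlt : ∫⁻ p, ‖p.1 - p.2‖ₑ ^ 2 ∂γ < ∞ := h.lintegral_le.trans_lt (ENNReal.add_lt_top.2
      ⟨ENNReal.mul_lt_top ENNReal.ofNat_lt_top hμ, ENNReal.mul_lt_top ENNReal.ofNat_lt_top hν⟩)
    rw [ofReal_integral_eq_lintegral_ofReal]
    · refine lintegral_congr fun p => ?_
      rw [ENNReal.ofReal_pow (norm_nonneg _), ofReal_norm]
    · refine ⟨by fun_prop, ?_⟩
      simpa [HasFiniteIntegral] using hlt
    · exact ae_of_all _ fun p => by positivity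
  refine le_antisymm (le_iInf₂ fun γ h => ?_) ?_
  · rw [← key γ h]
    refine ENNReal.ofReal_le_ofReal (csInf_le ⟨0, ?_⟩ ⟨γ, h, rfl⟩)
    rintro c ⟨γ, -, rfl⟩
    exact integral_nonneg fun p => by positivity
  · rw [← ENNReal.ofReal_toReal (W2e_lt_top hμ hν).ne]
    refine ENNReal.ofReal_le_ofReal (le_csInf ⟨_, _, isCoupling_prod μ ν, rfl⟩ ?_)
    rintro c ⟨γ, h, rfl⟩
    refine ENNReal.toReal_le_of_le_ofReal (integral_nonneg fun p => by positivity) ?_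
    rw [key γ h]
    exact W2e_le h

lemma lintegral_le_of_tendsto_of_continuous {X ι : Type*} [MeasurableSpace X] [TopologicalSpace X]
    [OpensMeasurableSpace X] {l : Filter ι} [l.NeBot] {P : ι → ProbabilityMeasure X}
    {Q : ProbabilityMeasure X} (h : Tendsto P l (𝓝 Q)) {g : X → ℝ≥0} (hg : Continuous g)
    {c : ℝ≥0∞} (hc : ∀ᶠ i in l, ∫⁻ x, g x ∂(P i : Measure X) ≤ c) :
    ∫⁻ x, g x ∂(Q : Measure X) ≤ c := by
  have hsup : ∀ x, (g x : ℝ≥0∞) = ⨆ L : ℕ, ((min (g x) L : ℝ≥0) : ℝ≥0∞) := by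
    intro x
    refine le_antisymm ?_ (iSup_le fun L => by exact_mod_cast min_le_left _ _)
    obtain ⟨L, hL⟩ := exists_nat_ge (g x)
    exact le_iSup_of_le L (by rw [min_eq_left hL])
  simp_rw [hsup]
  rw [lintegral_iSup (fun L => by fun_prop)
    (fun L L' hL x => by
      have : (L : ℝ≥0) ≤ L' := by exact_mod_cast hL
      exact ENNReal.coe_le_coe.2 (min_le_min_left _ this))]
  refine iSup_le fun L => ?_
  let f : X →ᵇ ℝ≥0 := BoundedContinuousFunction.mkOfBound ⟨fun x => min (g x) L, by fun_prop⟩ L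
    (fun x y => by
      rw [NNReal.dist_eq, abs_le]
      have h1 : ((min (g x) L : ℝ≥0) : ℝ) ≤ L := by exact_mod_cast min_le_right (g x) L
      have h2 : ((min (g y) L : ℝ≥0) : ℝ) ≤ L := by exact_mod_cast min_le_right (g y) L
      have h3 := (min (g x) L : ℝ≥0).2
      have h4 := (min (g y) L : ℝ≥0).2
      simp only [ContinuousMap.coe_mk]
      constructor <;> linarith [h1, h2, h3, h4])
  refine le_of_tendsto (ProbabilityMeasure.tendsto_iff_forall_lintegral_tendsto.1 h f) ?_
  filter_upwards [hc] with i hi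
  refine le_trans (lintegral_mono fun x => ?_) hi
  exact ENNReal.coe_le_coe.2 (min_le_left (g x) L)

lemma isTightMeasureSet_range_of_tendsto {α : ℕ → ProbabilityMeasure (En n)}
    {a : ProbabilityMeasure (En n)} (h : Tendsto α atTop (𝓝 a)) :
    IsTightMeasureSet {((μ : ProbabilityMeasure (En n)) : Measure (En n)) | μ ∈ range α} := by
  refine IsTightMeasureSet.subset (isTightMeasureSet_of_isCompact_closure
    (S := insert a (range α)) ?_) ?_
  · exact h.isCompact_insert_range.closure
  · rintro _ ⟨μ, hμ, rfl⟩
    exact ⟨μ, mem_insert_of_mem _ hμ, rfl⟩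

/-- Joint weak lower semicontinuity of the squared Wasserstein distance. -/
lemma W2e_le_liminf {α β : ℕ → ProbabilityMeasure (En n)} {a b : ProbabilityMeasure (En n)}
    (hα : Tendsto α atTop (𝓝 a)) (hβ : Tendsto β atTop (𝓝 b)) :
    W2e (a : Measure (En n)) b ≤ liminf (fun k => W2e (α k : Measure (En n)) (β k)) atTop := by
  by_contra! hlt
  obtain ⟨c, hc1, hc2⟩ := exists_between hlt
  have hfreq : ∃ᶠ k in atTop, W2e (α k : Measure (En n)) (β k) < c :=
    frequently_lt_of_liminf_lt (by isBoundedDefault) hc1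
  have hex : ∀ k, ∃ γ : ProbabilityMeasure (En n × En n),
      IsCoupling (γ : Measure (En n × En n)) (α k) (β k) ∧
      (W2e (α k : Measure (En n)) (β k) < c → ∫⁻ p, ‖p.1 - p.2‖ₑ ^ 2
        ∂(γ : Measure (En n × En n)) < c) := by
    intro k
    by_cases h : W2e (α k : Measure (En n)) (β k) < c
    · obtain ⟨γ, hγ, hγc⟩ := by simpa only [W2e, iInf_lt_iff] using h
      exact ⟨⟨γ, hγ.isProbabilityMeasure⟩, hγ, fun _ => hγc⟩
    · exact ⟨⟨_, (isCoupling_prod (α k : Measure (En n)) (β k)).isProbabilityMeasure⟩,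
        isCoupling_prod _ _, fun h' => absurd h' h⟩
  choose γ hγ hγc using hex
  have htight : IsTightMeasureSet
      {((μ : ProbabilityMeasure (En n × En n)) : Measure (En n × En n)) | μ ∈ range γ} := by
    refine IsTightMeasureSet.prodMk ?_ ?_
    · refine (isTightMeasureSet_range_of_tendsto hα).subset ?_
      rintro _ ⟨_, ⟨_, ⟨k, rfl⟩, rfl⟩, rfl⟩
      exact ⟨_, ⟨k, rfl⟩, (hγ k).1.symm⟩
    · refine (isTightMeasureSet_range_of_tendsto hβ).subset ?_
      rintro _ ⟨_, ⟨_, ⟨k, rfl⟩, rfl⟩, rfl⟩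
      exact ⟨_, ⟨k, rfl⟩, (hγ k).2.symm⟩
  have hcomp := isCompact_closure_of_isTightMeasureSet htight
  have : (atTop ⊓ 𝓟 {k | W2e (α k : Measure (En n)) (β k) < c}).NeBot :=
    frequently_mem_iff_neBot.1 hfreq
  set l : Filter ℕ := atTop ⊓ 𝓟 {k | W2e (α k : Measure (En n)) (β k) < c} with hl
  let u := Ultrafilter.of l
  have hul : (u : Filter ℕ) ≤ l := Ultrafilter.of_le l
  have hu_top : (u : Filter ℕ) ≤ atTop := hul.trans inf_le_left
  have hu_lt : ∀ᶠ k in (u : Filter ℕ), W2e (α k : Measure (En n)) (β k) < c :=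
    (hul.trans inf_le_right) (mem_principal_self _)
  obtain ⟨g, -, hg⟩ := hcomp.ultrafilter_le_nhds (u.map γ) (by
    refine le_principal_iff.2 (Filter.mem_of_superset ?_ subset_closure)
    exact Filter.mem_map.2 (Filter.Eventually.of_forall fun k => ⟨k, rfl⟩))
  have hg' : Tendsto γ u (𝓝 g) := hg
  have hcoup : IsCoupling (g : Measure (En n × En n)) a b := by
    constructor
    · have h1 := (ProbabilityMeasure.continuous_map (Ω := En n × En n) continuous_fst).tendsto g
        |>.comp hg'
      have h2 := tendsto_nhds_unique (h1.congr (f₂ := α) fun k => Subtype.ext (hγ k).1)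
        (hα.mono_left hu_top)
      exact congrArg Subtype.val h2
    · have h1 := (ProbabilityMeasure.continuous_map (Ω := En n × En n) continuous_snd).tendsto g
        |>.comp hg'
      have h2 := tendsto_nhds_unique (h1.congr (f₂ := β) fun k => Subtype.ext (hγ k).2)
        (hβ.mono_left hu_top)
      exact congrArg Subtype.val h2
  have hcost := lintegral_le_of_tendsto_of_continuous hg'
    (g := fun p : En n × En n => ‖p.1 - p.2‖₊ ^ 2) (by fun_prop) (c := c) (by
      filter_upwards [hu_lt] with k hk
      simpa [enorm_eq_nnnorm] using (hγc k hk).le)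
  have hcost' : ∫⁻ p, ‖p.1 - p.2‖ₑ ^ 2 ∂(g : Measure (En n × En n)) ≤ c := by
    simpa [enorm_eq_nnnorm] using hcost
  exact absurd ((W2e_le hcoup).trans hcost') (not_le.2 hc2)

/-- Reweighting the product of a measure with a coupling of `α` and `ν` by a density whose partial
integrals are all `1` yields a coupling of that measure and `ν`. -/
lemma isCoupling_map_withDensity {α α' ν : Measure (En n)} {γ : Measure (En n × En n)}
    [SFinite α'] [SFinite γ] (hγ : IsCoupling γ α ν) {G : En n × (En n × En n) → ℝ≥0∞}
    (hG : Measurable G) (h1 : ∀ᵐ x ∂α', ∫⁻ p, G (x, p) ∂γ = 1)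
    (h2 : ∀ᵐ p ∂γ, ∫⁻ x, G (x, p) ∂α' = 1) :
    IsCoupling (((α'.prod γ).withDensity G).map fun q => (q.1, q.2.2)) α' ν := by
  have hmap : Measurable fun q : En n × (En n × En n) => (q.1, q.2.2) := by fun_prop
  constructor
  · rw [Measure.map_map measurable_fst hmap]
    ext s hs
    have hs' : MeasurableSet ((Prod.fst ∘ fun q : En n × (En n × En n) => (q.1, q.2.2)) ⁻¹' s) :=
      (measurable_fst.comp hmap) hs
    rw [Measure.map_apply (by fun_prop) hs, withDensity_apply _ hs', ← lintegral_indicator hs',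
      lintegral_prod _ (hG.indicator hs').aemeasurable, ← lintegral_indicator_one hs]
    refine lintegral_congr_ae ?_
    filter_upwards [h1] with x hx
    by_cases hxs : x ∈ s <;> simp [indicator, hxs, hx]
  · rw [Measure.map_map measurable_snd hmap, ← hγ.2]
    ext s hs
    have hs' : MeasurableSet ((Prod.snd ∘ fun q : En n × (En n × En n) => (q.1, q.2.2)) ⁻¹' s) :=
      (measurable_snd.comp hmap) hs
    rw [Measure.map_apply (by fun_prop) hs, Measure.map_apply (by fun_prop) hs,
      withDensity_apply _ hs', ← lintegral_indicator hs',
      lintegral_prod_symm _ (hG.indicator hs').aemeasurable,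
      ← lintegral_indicator_one (measurable_snd hs)]
    refine lintegral_congr_ae ?_
    filter_upwards [h2] with p hp
    by_cases hps : p.2 ∈ s <;> simp [indicator, hps, hp]

lemma W2e_le_of_partition {ι : Type*} [Fintype ι] {f : ι → En n → ℝ≥0}
    (hf : ∀ j, Measurable (f j)) (hsum : ∀ x, ∑ j, f j x ≤ 1) {α α' ν : Measure (En n)}
    [IsProbabilityMeasure α] [IsProbabilityMeasure α'] (hα : ∀ᵐ x ∂α, ∑ j, f j x = 1)
    {R δ θ : ℝ≥0} (hα' : ∀ᵐ x ∂α', ‖x‖ₑ ≤ R)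
    (hdiam : ∀ j x x', f j x ≠ 0 → f j x' ≠ 0 → ‖x - x'‖ₑ ≤ δ) (hθδ : θ + δ = 1) (hθ0 : θ ≠ 0)
    {a a' : ι → ℝ≥0} (ha : ∀ j, ∫⁻ x, f j x ∂α = a j) (ha' : ∀ j, ∫⁻ x, f j x ∂α' = a' j)
    (haa' : ∀ j, θ * a j ≤ a' j) {γ : Measure (En n × En n)} (hγ : IsCoupling γ α ν) :
    W2e α' ν ≤ ∫⁻ p, (‖p.1 - p.2‖ₑ + δ) ^ 2 ∂γ + δ * (2 * R ^ 2 + 2 * secMom ν) := by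
  have := hγ.isProbabilityMeasure
  set c : ι → ℝ≥0 := fun j => θ / a' j with hc
  set A : En n → En n → ℝ≥0 := fun x' x => ∑ j, c j * f j x' * f j x with hA
  set H : En n → ℝ≥0 := fun x' => ∑ j, c j * a j * f j x' with hH
  have hca : ∀ j, c j * a j ≤ 1 := fun j => by
    rw [hc]
    simp only [div_mul_eq_mul_div]
    exact div_le_one_of_le₀ (haa' j) zero_le
  have hcaa : ∀ j, c j * a j * a' j = θ * a j := fun j => by
    by_cases h0 : a' j = 0
    · have := haa' j
      rw [h0] at this
      rw [h0, mul_zero, le_antisymm this zero_le]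
    · simp only [hc]
      field_simp
  have hH1 : ∀ x, H x ≤ 1 := fun x => by
    refine le_trans (Finset.sum_le_sum fun j _ => ?_) (hsum x)
    exact mul_le_of_le_one_left zero_le (hca j)
  have hf0 : ∀ᵐ x ∂α, ∀ j, a j = 0 → f j x = 0 := by
    refine ae_all_iff.2 fun j => ?_
    by_cases h0 : a j = 0
    · have h := ha j
      rw [h0, ENNReal.coe_zero, lintegral_eq_zero_iff (by fun_prop)] at h
      filter_upwards [h] with x hx _
      simpa using hx
    · exact ae_of_all _ fun x h => absurd h h0
  have hintA' : ∀ x', ∫⁻ p, A x' p.1 ∂γ = H x' := fun x' => by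
    rw [hγ.lintegral_fst (g := fun x => (A x' x : ℝ≥0∞)) (by fun_prop)]
    simp only [hA, hH, ENNReal.ofNNReal_finsetSum, ENNReal.coe_mul]
    rw [lintegral_finsetSum _ fun j _ => by fun_prop]
    refine Finset.sum_congr rfl fun j _ => ?_
    rw [lintegral_const_mul _ (by fun_prop), ha]
    ring
  have hintA : ∀ᵐ x ∂α, ∫⁻ x', A x' x ∂α' = θ := by
    filter_upwards [hα, hf0] with x hx hx0
    have : ∀ x', (A x' x : ℝ≥0∞) = ∑ j, ((c j * f j x : ℝ≥0) : ℝ≥0∞) * f j x' := fun x' => by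
      simp only [hA, ENNReal.ofNNReal_finsetSum, ENNReal.coe_mul]
      exact Finset.sum_congr rfl fun j _ => by ring
    simp_rw [this]
    rw [lintegral_finsetSum _ fun j _ => by fun_prop]
    have h2 : ∀ j, ∫⁻ x', ((c j * f j x : ℝ≥0) : ℝ≥0∞) * f j x' ∂α' =
        ((θ * f j x : ℝ≥0) : ℝ≥0∞) := by
      intro j
      rw [lintegral_const_mul _ (by fun_prop), ha', ← ENNReal.coe_mul]
      congr 1
      by_cases h0 : a' j = 0
      · have h3 := haa' j
        rw [h0] at h3
        have h4 : a j = 0 := by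
          simpa [hθ0] using le_antisymm h3 zero_le
        rw [hx0 j h4]
        simp
      · simp only [hc]
        field_simp
    simp_rw [h2]
    rw [← ENNReal.ofNNReal_finsetSum, ← Finset.mul_sum, hx, mul_one]
  have hintH : ∫⁻ x', H x' ∂α' = θ := by
    simp only [hH, ENNReal.ofNNReal_finsetSum, ENNReal.coe_mul]
    rw [lintegral_finsetSum _ fun j _ => by fun_prop]
    have : ∑ j, a j = 1 := by
      have h : ∫⁻ x, ((∑ j, f j x : ℝ≥0) : ℝ≥0∞) ∂α = 1 := by
        rw [lintegral_congr_ae (g := fun _ => 1) (by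
          filter_upwards [hα] with x hx
          rw [hx, ENNReal.coe_one])]
        simp
      simp only [ENNReal.ofNNReal_finsetSum] at h
      rw [lintegral_finsetSum _ fun j _ => by fun_prop] at h
      simp_rw [ha] at h
      exact_mod_cast h
    have h2 : ∀ j, ∫⁻ x', (c j : ℝ≥0∞) * a j * f j x' ∂α' = ((θ * a j : ℝ≥0) : ℝ≥0∞) := by
      intro j
      rw [lintegral_const_mul _ (by fun_prop), ha', ← hcaa j]
      push_cast
      rfl
    simp_rw [h2]
    rw [← ENNReal.ofNNReal_finsetSum, ← Finset.mul_sum, this, mul_one]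
  set B : En n → ℝ≥0 := fun x' => 1 - H x' with hB
  have hHB : ∀ x, (H x : ℝ≥0∞) + B x = 1 := fun x => by
    rw [← ENNReal.coe_add, hB, add_tsub_cancel_of_le (hH1 x), ENNReal.coe_one]
  have hθδ' : (θ : ℝ≥0∞) + δ = 1 := by exact_mod_cast hθδ
  have hintB : ∫⁻ x', B x' ∂α' = δ := by
    have h : ∫⁻ x', (H x' : ℝ≥0∞) + B x' ∂α' = 1 := by simp [hHB]
    rw [lintegral_add_left (by fun_prop), hintH, ← hθδ'] at h
    exact (ENNReal.add_right_inj ENNReal.coe_ne_top).1 h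
  set G : En n × (En n × En n) → ℝ≥0∞ := fun q => A q.1 q.2.1 + B q.1 with hG
  have hGm : Measurable G := by fun_prop
  have hcoup : IsCoupling (((α'.prod γ).withDensity G).map fun q => (q.1, q.2.2)) α' ν := by
    refine isCoupling_map_withDensity hγ hGm (ae_of_all _ fun x => ?_) ?_
    · simp only [hG]
      rw [lintegral_add_right _ (by fun_prop), hintA', lintegral_const, measure_univ, mul_one, hHB]
    · have h : ∀ᵐ p ∂γ, ∫⁻ x', A x' p.1 ∂α' = θ := by
        rw [← hγ.1] at hintA
        exact ae_of_ae_map measurable_fst.aemeasurable hintA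
      filter_upwards [h] with p hp
      simp only [hG]
      rw [lintegral_add_right _ (by fun_prop), hp, hintB, hθδ']
  refine (W2e_le hcoup).trans ?_
  rw [lintegral_map (by fun_prop) (by fun_prop), lintegral_withDensity_eq_lintegral_mul _ hGm
    (by fun_prop)]
  simp only [Pi.mul_apply, hG, add_mul]
  rw [lintegral_add_left (by fun_prop)]
  refine add_le_add ?_ ?_
  · rw [lintegral_prod_symm _ (by fun_prop)]
    have h : ∀ᵐ p ∂γ, ∫⁻ x', A x' p.1 ∂α' = θ := by
      rw [← hγ.1] at hintA
      exact ae_of_ae_map measurable_fst.aemeasurable hintA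
    refine lintegral_mono_ae ?_
    filter_upwards [h] with p hp
    calc ∫⁻ x', A x' p.1 * ‖x' - p.2‖ₑ ^ 2 ∂α'
        ≤ ∫⁻ x', A x' p.1 * (‖p.1 - p.2‖ₑ + δ) ^ 2 ∂α' := by
          refine lintegral_mono fun x' => ?_
          by_cases h0 : A x' p.1 = 0
          · simp [h0]
          · obtain ⟨j, -, hj⟩ := Finset.exists_ne_zero_of_sum_ne_zero h0
            have hj' := hdiam j x' p.1 (fun h => hj (by simp [h])) (fun h => hj (by simp [h]))
            gcongr
            calc ‖x' - p.2‖ₑ = ‖(p.1 - p.2) + (x' - p.1)‖ₑ := by congr 1; abel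
              _ ≤ ‖p.1 - p.2‖ₑ + ‖x' - p.1‖ₑ := enorm_add_le _ _
              _ ≤ _ := by gcongr
      _ = θ * (‖p.1 - p.2‖ₑ + δ) ^ 2 := by rw [lintegral_mul_const _ (by fun_prop), hp]
      _ ≤ (‖p.1 - p.2‖ₑ + δ) ^ 2 := mul_le_of_le_one_left zero_le (hθδ' ▸ le_self_add)
  · rw [lintegral_prod _ (by fun_prop)]
    calc ∫⁻ x', ∫⁻ p, B x' * ‖x' - p.2‖ₑ ^ 2 ∂γ ∂α'
        ≤ ∫⁻ x', B x' * (2 * R ^ 2 + 2 * secMom ν) ∂α' := by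
          refine lintegral_mono_ae ?_
          filter_upwards [hα'] with x' hx'
          rw [lintegral_const_mul _ (by fun_prop)]
          gcongr
          calc ∫⁻ p, ‖x' - p.2‖ₑ ^ 2 ∂γ ≤ ∫⁻ p, 2 * R ^ 2 + 2 * ‖p.2‖ₑ ^ 2 ∂γ := by
                refine lintegral_mono fun p => (enorm_sub_sq_le x' p.2).trans ?_
                gcongr
            _ = _ := by
                rw [lintegral_add_left (by fun_prop), lintegral_const, measure_univ, mul_one,
                  lintegral_const_mul _ (by fun_prop),
                  hγ.lintegral_snd (g := fun x => ‖x‖ₑ ^ 2) (by fun_prop)]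
                rfl
      _ = δ * (2 * R ^ 2 + 2 * secMom ν) := by rw [lintegral_mul_const _ (by fun_prop), hintB]

lemma exists_fine_partition (R : ℝ≥0) {δ : ℝ≥0} (hδ : 0 < δ) :
    ∃ (ι : Type) (_ : Fintype ι) (f : ι → En n → ℝ≥0), (∀ j, Continuous (f j)) ∧
      (∀ x, ∑ j, f j x ≤ 1) ∧ (∀ x, ‖x‖ₑ ≤ R → ∑ j, f j x = 1) ∧
      ∀ j x x', f j x ≠ 0 → f j x' ≠ 0 → ‖x - x'‖ₑ ≤ δ := by
  obtain ⟨t, -, htfin, ht⟩ := (isCompact_closedBall (0 : En n) R).finite_cover_balls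
    (half_pos (NNReal.coe_pos.2 hδ))
  have := htfin.fintype
  obtain ⟨ρ, hρ⟩ := PartitionOfUnity.exists_isSubordinate
    (Metric.isClosed_closedBall (x := (0 : En n)) (ε := R))
    (fun i : t => Metric.ball (i : En n) (δ / 2)) (fun _ => Metric.isOpen_ball)
    (by rwa [biUnion_eq_iUnion] at ht)
  have hsum : ∀ x, ((∑ j, (ρ j x).toNNReal : ℝ≥0) : ℝ) = ∑ᶠ j, ρ j x := fun x => by
    rw [finsum_eq_sum_of_fintype, NNReal.coe_sum]
    exact Finset.sum_congr rfl fun j _ => Real.coe_toNNReal _ (ρ.nonneg j x)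
  refine ⟨t, this, fun j x => (ρ j x).toNNReal, fun j => by fun_prop, fun x => ?_,
    fun x hx => ?_, fun j x x' hx hx' => ?_⟩
  · rw [← NNReal.coe_le_coe, hsum]
    exact ρ.sum_le_one x
  · rw [← NNReal.coe_inj, hsum, NNReal.coe_one]
    refine ρ.sum_eq_one (mem_closedBall_zero_iff.2 ?_)
    rw [enorm_eq_nnnorm] at hx
    exact_mod_cast hx
  · have hmem : ∀ y, (ρ j y).toNNReal ≠ 0 → y ∈ Metric.ball (j : En n) (δ / 2) := fun y hy =>
      hρ j (subset_tsupport _ fun h => hy (by simp [h]))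
    have h1 := hmem x hx
    have h2 := hmem x' hx'
    rw [Metric.mem_ball] at h1 h2
    have h3 := dist_triangle_right x x' (j : En n)
    rw [dist_eq_norm] at h3
    have h4 : ‖x - x'‖ ≤ δ := by linarith
    rw [enorm_eq_nnnorm]
    exact_mod_cast h4

lemma enorm_add_coe_sq_le (x : En n) {δ : ℝ≥0} (hδ : δ ≤ 1) :
    (‖x‖ₑ + δ) ^ 2 ≤ ‖x‖ₑ ^ 2 + δ * (‖x‖ₑ ^ 2 + 2) := by
  have h : (‖x‖₊ + δ) ^ 2 ≤ ‖x‖₊ ^ 2 + δ * (‖x‖₊ ^ 2 + 2) := by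
    rw [← NNReal.coe_le_coe] at hδ ⊢
    push_cast at hδ ⊢
    nlinarith [δ.2, mul_nonneg δ.2 (sq_nonneg (‖x‖ - 1)), mul_nonneg δ.2 (sub_nonneg.2 hδ)]
  simp only [enorm_eq_nnnorm]
  exact_mod_cast h

/-- Along weakly convergent sequences of uniformly bounded support, the Wasserstein distance to a
measure with finite second moment is upper semicontinuous. -/
lemma limsup_W2e_le {α : ℕ → ProbabilityMeasure (En n)} {a : ProbabilityMeasure (En n)}
    (hα : Tendsto α atTop (𝓝 a)) {R : ℝ≥0} (hαR : ∀ k, ∀ᵐ x ∂(α k : Measure (En n)), ‖x‖ₑ ≤ R)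
    (haR : ∀ᵐ x ∂(a : Measure (En n)), ‖x‖ₑ ≤ R) {ν : Measure (En n)} (hν : secMom ν < ∞) :
    limsup (fun k => W2e (α k : Measure (En n)) ν) atTop ≤ W2e (a : Measure (En n)) ν := by
  refine le_of_forall_gt fun c hc => ?_
  obtain ⟨b, hab, hbc⟩ := exists_between hc
  refine lt_of_le_of_lt ?_ hbc
  obtain ⟨γ, hγ, hγb⟩ := by simpa only [W2e, iInf_lt_iff] using hab
  have := hγ.isProbabilityMeasure
  set C := ∫⁻ p, ‖p.1 - p.2‖ₑ ^ 2 ∂γ with hC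
  set D := (C + 2) + (2 * (R : ℝ≥0∞) ^ 2 + 2 * secMom ν) with hD
  have hDtop : D ≠ ∞ := by
    simp only [hD, ne_eq, ENNReal.add_eq_top, not_or]
    exact ⟨⟨(hγb.trans_le le_top).ne, by simp⟩, by finiteness,
      ENNReal.mul_ne_top (by simp) hν.ne⟩
  obtain ⟨δ, ⟨hδ0, hδ1⟩, hδb⟩ : ∃ δ : ℝ≥0, (0 < δ ∧ δ < 1) ∧ C + δ * D < b := by
    have hlim : Tendsto (fun δ : ℝ≥0 => C + δ * D) (𝓝[>] 0) (𝓝 (C + (0 : ℝ≥0) * D)) :=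
      ((ENNReal.Tendsto.mul_const (ENNReal.tendsto_coe.2 tendsto_id)
        (Or.inr hDtop)).const_add C).mono_left nhdsWithin_le_nhds
    have h1 := hlim.eventually_lt_const (u := b) (by simpa using hγb)
    have h2 : ∀ᶠ δ : ℝ≥0 in 𝓝[>] 0, δ ∈ Ioo (0 : ℝ≥0) 1 :=
      Ioo_mem_nhdsGT zero_lt_one
    exact (h2.and h1).exists
  obtain ⟨ι, _, f, hf, hf1, hfR, hfδ⟩ := exists_fine_partition (n := n) R hδ0
  have hfin : ∀ (m : ProbabilityMeasure (En n)) j, ∫⁻ x, f j x ∂(m : Measure (En n)) ≠ ∞ := by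
    intro m j
    refine ne_top_of_le_ne_top ENNReal.one_ne_top ?_
    calc ∫⁻ x, f j x ∂(m : Measure (En n)) ≤ ∫⁻ _, 1 ∂(m : Measure (En n)) :=
          lintegral_mono fun x => by
            exact ENNReal.coe_le_one_iff.2 ((Finset.single_le_sum (f := fun j => f j x)
              (fun _ _ => zero_le) (Finset.mem_univ j)).trans (hf1 x))
      _ = 1 := by simp
  have hlim : ∀ j, Tendsto (fun k => ∫⁻ x, f j x ∂(α k : Measure (En n))) atTop
      (𝓝 (∫⁻ x, f j x ∂(a : Measure (En n)))) := fun j =>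
    ProbabilityMeasure.tendsto_iff_forall_lintegral_tendsto.1 hα
      (BoundedContinuousFunction.mkOfBound ⟨f j, hf j⟩ 1 (fun x y => by
        have h : ∀ z, (f j z : ℝ) ≤ 1 := fun z => by
          exact_mod_cast (Finset.single_le_sum (f := fun j => f j z) (fun _ _ => zero_le)
              (Finset.mem_univ j)).trans (hf1 z)
        rw [NNReal.dist_eq, abs_le]
        simp only [ContinuousMap.coe_mk]
        constructor <;> linarith [h x, h y, (f j x).2, (f j y).2]))
  have hev : ∀ᶠ k in atTop, ∀ j, ((1 - δ : ℝ≥0) : ℝ≥0∞) * ∫⁻ x, f j x ∂(a : Measure (En n)) ≤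
      ∫⁻ x, f j x ∂(α k : Measure (En n)) := by
    refine eventually_all.2 fun j => ?_
    by_cases h0 : ∫⁻ x, f j x ∂(a : Measure (En n)) = 0
    · simp [h0]
    · refine ((hlim j).eventually_const_lt ?_).mono fun k hk => hk.le
      refine (ENNReal.mul_lt_mul_left h0 (hfin a j) (c := 1) ?_).trans_eq (one_mul _)
      exact_mod_cast tsub_lt_self one_pos hδ0
  refine limsup_le_of_le (by isBoundedDefault) ?_
  filter_upwards [hev] with k hk
  have hmain := W2e_le_of_partition (fun j => (hf j).measurable) hf1
    (α := (a : Measure (En n))) (α' := (α k : Measure (En n)))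
    (haR.mono fun x hx => hfR x hx) (hαR k) hfδ (θ := 1 - δ) (tsub_add_cancel_of_le hδ1.le)
    (tsub_pos_of_lt hδ1).ne' (fun j => (ENNReal.coe_toNNReal (hfin a j)).symm)
    (fun j => (ENNReal.coe_toNNReal (hfin (α k) j)).symm)
    (fun j => by
      rw [← ENNReal.coe_le_coe, ENNReal.coe_mul, ENNReal.coe_toNNReal (hfin a j),
        ENNReal.coe_toNNReal (hfin (α k) j)]
      exact hk j) hγ
  refine hmain.trans (le_trans ?_ hδb.le)
  have hγδ : ∫⁻ p, (‖p.1 - p.2‖ₑ + δ) ^ 2 ∂γ ≤ C + δ * (C + 2) := by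
    calc ∫⁻ p, (‖p.1 - p.2‖ₑ + δ) ^ 2 ∂γ
        ≤ ∫⁻ p, ‖p.1 - p.2‖ₑ ^ 2 + δ * (‖p.1 - p.2‖ₑ ^ 2 + 2) ∂γ :=
          lintegral_mono fun p => enorm_add_coe_sq_le _ hδ1.le
      _ = C + δ * (C + 2) := by
          rw [lintegral_add_left (by fun_prop), lintegral_const_mul _ (by fun_prop),
            lintegral_add_left (by fun_prop), lintegral_const, measure_univ, mul_one]
  calc _ ≤ C + δ * (C + 2) + δ * (2 * R ^ 2 + 2 * secMom ν) := by gcongr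
    _ = C + δ * D := by rw [hD]; ring

lemma continuous_W2e {P : ℝ → ProbabilityMeasure (En n)} (hP : Continuous P) {R : ℝ≥0}
    (hPR : ∀ t, ∀ᵐ x ∂(P t : Measure (En n)), ‖x‖ₑ ≤ R) {ν : ProbabilityMeasure (En n)}
    (hν : secMom (ν : Measure (En n)) < ∞) :
    Continuous fun t => W2e (P t : Measure (En n)) (ν : Measure (En n)) := by
  refine continuous_iff_continuousAt.2 fun t => tendsto_of_seq_tendsto fun u hu => ?_
  have hPu : Tendsto (fun k => P (u k)) atTop (𝓝 (P t)) := (hP.tendsto t).comp hu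
  have h1 : W2e (P t : Measure (En n)) (ν : Measure (En n)) ≤
      liminf (fun k => W2e (P (u k) : Measure (En n)) (ν : Measure (En n))) atTop :=
    W2e_le_liminf hPu (tendsto_const_nhds (x := ν))
  have h2 : limsup (fun k => W2e (P (u k) : Measure (En n)) (ν : Measure (En n))) atTop ≤
      W2e (P t : Measure (En n)) (ν : Measure (En n)) :=
    limsup_W2e_le hPu (fun k => hPR (u k)) (hPR t) hν
  exact tendsto_of_le_liminf_of_limsup_le h1 h2

lemma setLIntegral_natCeil_div (g : ℝ → ℝ≥0∞) {N : ℕ} (hN : 0 < N) :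
    ∫⁻ t in Ioc (0 : ℝ) 1, g (⌈t * N⌉₊ / N) =
      (∑ i ∈ Finset.range N, g ((i + 1) / N)) * ENNReal.ofReal (1 / N) := by
  have hN' : (0 : ℝ) < N := Nat.cast_pos.2 hN
  have hmem : ∀ (i : ℕ) (t : ℝ), t ∈ Ioc ((i : ℝ) / N) ((i + 1) / N) ↔ ⌈t * N⌉₊ = i + 1 := by
    intro i t
    rw [Nat.ceil_eq_iff i.succ_ne_zero, mem_Ioc, div_lt_iff₀ hN', le_div_iff₀ hN']
    simp
  have hunion : Ioc (0 : ℝ) 1 = ⋃ i ∈ Finset.range N, Ioc ((i : ℝ) / N) ((i + 1) / N) := by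
    ext t
    simp only [mem_iUnion, hmem, Finset.mem_range, exists_prop]
    constructor
    · rintro ⟨h0, h1⟩
      have hpos : 0 < ⌈t * N⌉₊ := Nat.ceil_pos.2 (by positivity)
      have hle : ⌈t * N⌉₊ ≤ N := Nat.ceil_le.2 (by nlinarith)
      exact ⟨⌈t * N⌉₊ - 1, by omega, by omega⟩
    · rintro ⟨i, hi, hti⟩
      have hpos : 0 < t * N := Nat.ceil_pos.1 (by omega)
      have hle : t * N ≤ N := Nat.ceil_le.1 (by omega)
      exact ⟨pos_of_mul_pos_left hpos hN'.le, by nlinarith⟩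
  rw [hunion, lintegral_biUnion_finset (fun i _ j _ hij => ?_) (fun i _ => measurableSet_Ioc),
    Finset.sum_mul]
  · refine Finset.sum_congr rfl fun i _ => ?_
    rw [setLIntegral_congr_fun (g := fun _ => g ((i + 1) / N)) measurableSet_Ioc
      (fun t ht => by simp only [(hmem i t).1 ht]; push_cast; rfl), setLIntegral_const,
      Real.volume_Ioc]
    congr 2
    ring
  · refine Set.disjoint_left.2 fun t hi hj => hij ?_
    rw [hmem] at hi hj
    omega

lemma secMom_le_of_ae_le {μ : Measure (En n)} [IsProbabilityMeasure μ] {R : ℝ≥0}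
    (h : ∀ᵐ x ∂μ, ‖x‖ₑ ≤ R) : secMom μ ≤ R ^ 2 := by
  calc secMom μ ≤ ∫⁻ _, (R : ℝ≥0∞) ^ 2 ∂μ := lintegral_mono_ae (h.mono fun x hx => by gcongr)
    _ = R ^ 2 := by simp

lemma W2e_le_of_ae_le {μ ν : Measure (En n)} [IsProbabilityMeasure μ] [IsProbabilityMeasure ν]
    {R : ℝ≥0} (h : ∀ᵐ x ∂μ, ‖x‖ₑ ≤ R) : W2e μ ν ≤ 2 * R ^ 2 + 2 * secMom ν :=
  (W2e_le_secMom μ ν).trans (by gcongr; exact secMom_le_of_ae_le h)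

/-- Minimality for the equidistributed Riemann sums passes to weak limits. -/
lemma lintegral_W2e_le_of_tendsto {P : ℝ → ProbabilityMeasure (En n)} (hP : Continuous P)
    {R : ℝ≥0} (hPR : ∀ t, ∀ᵐ x ∂(P t : Measure (En n)), ‖x‖ₑ ≤ R) {φ : ℕ → ℕ}
    (hφ : Tendsto φ atTop atTop) (hφpos : ∀ k, 0 < φ k) {Q : ℕ → ProbabilityMeasure (En n)}
    {Q' ν : ProbabilityMeasure (En n)} (hQ : Tendsto Q atTop (𝓝 Q'))
    (hν : secMom (ν : Measure (En n)) < ∞)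
    (hmin : ∀ k, ∑ i ∈ Finset.range (φ k),
        W2e (P (((i : ℝ) + 1) / φ k) : Measure (En n)) (Q k : Measure (En n)) ≤
      ∑ i ∈ Finset.range (φ k),
        W2e (P (((i : ℝ) + 1) / φ k) : Measure (En n)) (ν : Measure (En n))) :
    ∫⁻ t in Ioc (0 : ℝ) 1, W2e (P t : Measure (En n)) (Q' : Measure (En n)) ≤
      ∫⁻ t in Ioc (0 : ℝ) 1, W2e (P t : Measure (En n)) (ν : Measure (En n)) := by
  have hτ : ∀ t : ℝ, 0 ≤ t →
      Tendsto (fun k => (⌈t * (φ k : ℝ)⌉₊ : ℝ) / (φ k : ℝ)) atTop (𝓝 t) :=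
    fun t ht => (tendsto_nat_ceil_mul_div_atTop ht).comp (tendsto_natCast_atTop_atTop.comp hφ)
  have hmeas : ∀ (m : ProbabilityMeasure (En n)) (k : ℕ), Measurable fun t : ℝ =>
      W2e (P ((⌈t * (φ k : ℝ)⌉₊ : ℝ) / (φ k : ℝ)) : Measure (En n)) (m : Measure (En n)) :=
    fun m k => (measurable_from_top (f := fun j : ℕ =>
      W2e (P ((j : ℝ) / (φ k : ℝ)) : Measure (En n)) (m : Measure (En n)))).comp
        (Nat.measurable_ceil.comp (measurable_id.mul_const _))
  have hlim : Tendsto (fun k => ∫⁻ t in Ioc (0 : ℝ) 1,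
      W2e (P ((⌈t * (φ k : ℝ)⌉₊ : ℝ) / (φ k : ℝ)) : Measure (En n)) (ν : Measure (En n))) atTop
      (𝓝 (∫⁻ t in Ioc (0 : ℝ) 1, W2e (P t : Measure (En n)) (ν : Measure (En n)))) := by
    refine tendsto_lintegral_filter_of_dominated_convergence
      (fun _ => 2 * (R : ℝ≥0∞) ^ 2 + 2 * secMom (ν : Measure (En n)))
      (.of_forall fun k => hmeas ν k)
      (.of_forall fun k => ae_of_all _ fun t => W2e_le_of_ae_le (hPR _)) ?_ ?_
    · rw [setLIntegral_const, Real.volume_Ioc]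
      have := hν.ne
      finiteness
    · refine (ae_restrict_iff' measurableSet_Ioc).2 (ae_of_all _ fun t ht => ?_)
      exact ((continuous_W2e hP hPR hν).tendsto t).comp (hτ t ht.1.le)
  calc ∫⁻ t in Ioc (0 : ℝ) 1, W2e (P t : Measure (En n)) (Q' : Measure (En n))
      ≤ ∫⁻ t in Ioc (0 : ℝ) 1, liminf (fun k => W2e
          (P ((⌈t * (φ k : ℝ)⌉₊ : ℝ) / (φ k : ℝ)) : Measure (En n)) (Q k : Measure (En n))) atTop :=
        setLIntegral_mono' measurableSet_Ioc fun t ht =>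
          W2e_le_liminf (α := fun k => P ((⌈t * (φ k : ℝ)⌉₊ : ℝ) / (φ k : ℝ)))
            ((hP.tendsto t).comp (hτ t ht.1.le)) hQ
    _ ≤ liminf (fun k => ∫⁻ t in Ioc (0 : ℝ) 1, W2e
          (P ((⌈t * (φ k : ℝ)⌉₊ : ℝ) / (φ k : ℝ)) : Measure (En n)) (Q k : Measure (En n))) atTop :=
        lintegral_liminf_le fun k => hmeas (Q k) k
    _ ≤ liminf (fun k => ∫⁻ t in Ioc (0 : ℝ) 1, W2e
         (P ((⌈t * (φ k : ℝ)⌉₊ : ℝ) / (φ k : ℝ)) : Measure (En n)) (ν : Measure (En n))) atTop := by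
        refine liminf_le_liminf (.of_forall fun k => ?_)
        rw [setLIntegral_natCeil_div (fun s => W2e (P s : Measure (En n)) (Q k : Measure (En n)))
            (hφpos k),
          setLIntegral_natCeil_div (fun s => W2e (P s : Measure (En n)) (ν : Measure (En n)))
            (hφpos k)]
        exact mul_le_mul_left (hmin k) _
    _ = ∫⁻ t in Ioc (0 : ℝ) 1, W2e (P t : Measure (En n)) (ν : Measure (En n)) := hlim.liminf_eq

end Wasserstein

/-- if `μ^N` is the equal-weight Wasserstein barycenter of
`μ_{1/N},…,μ_{N/N}`, then any weak limit of a subsequence of `(μ^N)` is a barycenter of the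
curve `t ↦ μ_t`, i.e. it minimizes `ν ↦ ∫₀¹ W₂²(μ_t, ν) dt`. -/
theorem stmt19 {n : ℕ} (M : Set (En n)) (hM : Bornology.IsBounded M)
    (μ : ℝ → Measure (En n)) (hprob : ∀ t ∈ Icc (0:ℝ) 1, IsProbabilityMeasure (μ t))
    (hsupp : ∀ t ∈ Icc (0:ℝ) 1, μ t Mᶜ = 0)
    (hcont : WeakContOn μ (Icc 0 1))
    (μN : ℕ → Measure (En n))
    (hN : ∀ N : ℕ, 0 < N → IsProbabilityMeasure (μN N) ∧ FinSecMom (μN N) ∧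
      ∀ ν : Measure (En n), IsProbabilityMeasure ν → FinSecMom ν →
        ∑ i ∈ Finset.range N, W2sq (μ (((i : ℝ) + 1) / N)) (μN N) ≤
          ∑ i ∈ Finset.range N, W2sq (μ (((i : ℝ) + 1) / N)) ν)
    (φ : ℕ → ℕ) (hφ : StrictMono φ) (hφ0 : 0 < φ 0)
    (μinf : Measure (En n)) [IsProbabilityMeasure μinf]
    (hconv : ∀ f : BoundedContinuousFunction (En n) ℝ,
      Filter.Tendsto (fun k => ∫ x, f x ∂(μN (φ k))) Filter.atTop
        (nhds (∫ x, f x ∂μinf))) :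
    IsBarycenter μ μinf := by
  obtain ⟨R, hR0, hR⟩ := hM.exists_pos_norm_le
  lift R to NNReal using hR0.le
  obtain ⟨P, hPdef⟩ : ∃ P : ℝ → ProbabilityMeasure (En n),
      ∀ t, (P t : Measure (En n)) = μ (projIcc 0 1 zero_le_one t) :=
    ⟨fun t => ⟨μ (projIcc 0 1 zero_le_one t), hprob _ (projIcc 0 1 zero_le_one t).2⟩,
      fun _ => rfl⟩
  have hPμ : ∀ t ∈ Icc (0 : ℝ) 1, (P t : Measure (En n)) = μ t := fun t ht => by
    rw [hPdef, projIcc_of_mem zero_le_one ht]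
  have hP : Continuous P := by
    refine ProbabilityMeasure.continuous_iff_forall_continuous_integral.2 fun f => ?_
    simp only [hPdef]
    exact (continuousOn_iff_continuous_domRestrict.1 (hcont f)).comp continuous_projIcc
  have hPR : ∀ t, ∀ᵐ x ∂(P t : Measure (En n)), ‖x‖ₑ ≤ R := by
    intro t
    have h0 : (P t : Measure (En n)) Mᶜ = 0 := by
      rw [hPdef]
      exact hsupp _ (projIcc 0 1 zero_le_one t).2
    filter_upwards [measure_eq_zero_iff_ae_notMem.1 h0] with x hx
    rw [enorm_eq_nnnorm]
    exact_mod_cast hR x (by simpa using hx)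
  have hPmom : ∀ t, secMom (P t : Measure (En n)) ≤ R ^ 2 := fun t => secMom_le_of_ae_le (hPR t)
  have hPfin : ∀ t, secMom (P t : Measure (En n)) < ⊤ := fun t =>
    (hPmom t).trans_lt (by finiteness)
  have hφpos : ∀ k, 0 < φ k := fun k => hφ0.trans_le (hφ.monotone k.zero_le)
  have hmin : ∀ N : ℕ, 0 < N → ∀ ν : Measure (En n), IsProbabilityMeasure ν → FinSecMom ν →
      ∑ i ∈ Finset.range N, W2e (P (((i : ℝ) + 1) / N) : Measure (En n)) (μN N) ≤
        ∑ i ∈ Finset.range N, W2e (P (((i : ℝ) + 1) / N) : Measure (En n)) ν := by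
    intro N hNpos ν hν hνm
    obtain ⟨hp, hm, hle⟩ := hN N hNpos
    have hconv' : ∀ m : Measure (En n), IsProbabilityMeasure m → FinSecMom m →
        ∑ i ∈ Finset.range N, W2e (P (((i : ℝ) + 1) / N) : Measure (En n)) m =
          ENNReal.ofReal (∑ i ∈ Finset.range N, W2sq (μ (((i : ℝ) + 1) / N)) m) := by
      intro m _ hm
      rw [ENNReal.ofReal_sum_of_nonneg fun i _ => W2sq_nonneg _ _]
      refine Finset.sum_congr rfl fun i hi => ?_
      have hi' : ((i : ℝ) + 1) / N ∈ Icc (0 : ℝ) 1 := by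
        have : (i : ℝ) + 1 ≤ N := by exact_mod_cast Finset.mem_range.1 hi
        exact ⟨by positivity, div_le_one_of_le₀ this (by positivity)⟩
      rw [← hPμ _ hi', ofReal_W2sq (hPfin _) (secMom_lt_top hm)]
    rw [hconv' _ hp hm, hconv' _ hν hνm]
    exact ENNReal.ofReal_le_ofReal (hle ν hν hνm)
  have hmomN : ∀ N : ℕ, 0 < N → secMom (μN N) ≤ 6 * (R : ENNReal) ^ 2 := by
    intro N hNpos
    have hp := (hN N hNpos).1
    have hd : secMom (Measure.dirac (0 : En n)) = 0 := by
      simp [secMom]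
    have h0 := hmin N hNpos (Measure.dirac 0) inferInstance
      (finSecMom_of_secMom_lt_top (by simp [hd]))
    have h1 : ∑ i ∈ Finset.range N, W2e (P (((i : ℝ) + 1) / N) : Measure (En n))
        (Measure.dirac 0) ≤ ∑ i ∈ Finset.range N, 2 * (R : ENNReal) ^ 2 := by
      refine Finset.sum_le_sum fun i _ => (W2e_le_secMom _ _).trans ?_
      rw [hd, mul_zero, add_zero]
      gcongr
      exact hPmom _
    have h2 : ∑ i ∈ Finset.range N, secMom (μN N) ≤
        ∑ i ∈ Finset.range N, 2 * (R : ENNReal) ^ 2 + 2 * ∑ i ∈ Finset.range N,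
          W2e (P (((i : ℝ) + 1) / N) : Measure (En n)) (μN N) := by
      rw [Finset.mul_sum, ← Finset.sum_add_distrib]
      refine Finset.sum_le_sum fun i _ => (secMom_le_W2e (P (((i : ℝ) + 1) / N)) _).trans ?_
      gcongr
      exact hPmom _
    have h3 := h2.trans (add_le_add_right (mul_le_mul_right (h0.trans h1) 2) _)
    simp only [Finset.sum_const, Finset.card_range, nsmul_eq_mul] at h3
    rw [← ENNReal.mul_le_mul_iff_right (a := (N : ENNReal)) (by exact_mod_cast hNpos.ne')
      (by simp)]
    refine h3.trans_eq ?_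
    ring
  let Q : ℕ → ProbabilityMeasure (En n) := fun k => ⟨μN (φ k), (hN _ (hφpos k)).1⟩
  let Qinf : ProbabilityMeasure (En n) := ⟨μinf, inferInstance⟩
  have hQ : Filter.Tendsto Q Filter.atTop (nhds Qinf) :=
    ProbabilityMeasure.tendsto_iff_forall_integral_tendsto.2 hconv
  have hinf : secMom μinf < ⊤ := by
    have h := lintegral_le_of_tendsto_of_continuous hQ (g := fun x : En n => ‖x‖₊ ^ 2)
      (by fun_prop) (c := 6 * (R : ENNReal) ^ 2)
      (Filter.Eventually.of_forall fun k => by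
        simpa [secMom, enorm_eq_nnnorm, Q] using hmomN _ (hφpos k))
    refine lt_of_le_of_lt ?_ (lt_of_le_of_lt h (by finiteness))
    simp [secMom, enorm_eq_nnnorm, Qinf]
  refine ⟨inferInstance, finSecMom_of_secMom_lt_top hinf, fun ν hν hνm => ?_⟩
  have hνfin := secMom_lt_top hνm
  have key := lintegral_W2e_le_of_tendsto hP hPR hφ.tendsto_atTop hφpos hQ
    (ν := ⟨ν, hν⟩) hνfin (fun k => hmin (φ k) (hφpos k) ν hν hνm)
  have hint : ∀ m : ProbabilityMeasure (En n), secMom (m : Measure (En n)) < ⊤ →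
      ∫ t in Icc (0 : ℝ) 1, W2sq (μ t) m =
        (∫⁻ t in Ioc (0 : ℝ) 1, W2e (P t : Measure (En n)) (m : Measure (En n))).toReal := by
    intro m hm
    rw [integral_Icc_eq_integral_Ioc, ← integral_toReal
      (continuous_W2e hP hPR hm).measurable.aemeasurable
      (ae_of_all _ fun t => W2e_lt_top (hPfin t) hm)]
    refine setIntegral_congr_fun measurableSet_Ioc fun t ht => ?_
    rw [← ofReal_W2sq (hPfin t) hm, ENNReal.toReal_ofReal (W2sq_nonneg _ _),
      hPμ t (Ioc_subset_Icc_self ht)]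
  refine (hint ⟨μinf, inferInstance⟩ hinf).trans_le (le_of_le_of_eq ?_ (hint ⟨ν, hν⟩ hνfin).symm)
  refine ENNReal.toReal_mono (ne_top_of_le_ne_top ?_
    (lintegral_mono fun t => W2e_le_of_ae_le (ν := ν) (hPR t))) key
  rw [setLIntegral_const, Real.volume_Ioc]
  have : secMom ν ≠ ⊤ := hνfin.ne
  exact ENNReal.mul_ne_top (ENNReal.add_ne_top.2 ⟨by finiteness, ENNReal.mul_ne_top (by simp) this⟩)
    (by simp)
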